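/- arXiv:1308.5104 — 2 statements merged into one kernel-verified Lean document; each statement's English description precedes it below -/
import Mathlib

section
/- Let K be a field, D an associative unital K-algebra, A a unital K-subalgebra of D, T a K-linear subspace of D, and E a unital K-subalgebra of the algebra End_K(D) of K-linear endomorphisms of D. Assume: (i) for every a ∈ A the left multiplication map d ↦ ad on D belongs to E; (ii) ξ(A) ⊆ A for every ξ ∈ E; (iii) ξ(d·t) = ξ(d)·t for all ξ ∈ E, d ∈ D and t ∈ T; (iv) A ≠ 0 and the only E-stable K-subspaces of A are 0 and A; (v) every K-linear map φ : A → A commuting with the action of every ξ ∈ E is multiplication by a scalar in K. Then whenever α_1, …, α_m ∈ A are K-linearly independent and t_1, …, t_m ∈ T satisfy α_1·t_1 + ⋯ + α_m·t_m = 0 in D, we have t_1 = ⋯ = t_m = 0; equivalently, the multiplication map A ⊗_K T → D is injective. -/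
/-- abstract form of Theorem 3.2: Let `K` be a field, `D` a `K`-algebra,
`A` a unital `K`-subalgebra of `D`, `T` a `K`-subspace of `D` and `E` a unital `K`-subalgebra of
`End_K D` such that: left multiplications by elements of `A` lie in `E`; `A` is `E`-stable;
every `ξ ∈ E` commutes with right multiplication by elements of `T`; `A ≠ 0` and the only
`E`-stable subspaces of `A` are `0` and `A`; and every `K`-linear endomorphism of `A`
commuting with `E` is a scalar.  Then the multiplication map `A ⊗_K T → D` is injective:
if `α_1, …, α_m ∈ A` are `K`-linearly independent and `t_1, …, t_m ∈ T` satisfy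
`Σ α_i t_i = 0`, then all `t_i = 0`. -/
theorem mul_map_injective_of_simple {K D : Type*} [Field K] [Ring D] [Algebra K D]
    (A : Subalgebra K D) (T : Submodule K D) (E : Subalgebra K (Module.End K D))
    (h1 : ∀ a ∈ A, (LinearMap.mulLeft K a : Module.End K D) ∈ E)
    (h2 : ∀ ξ ∈ E, ∀ a ∈ A, ξ a ∈ A)
    (h3 : ∀ ξ ∈ E, ∀ d : D, ∀ t ∈ T, ξ (d * t) = ξ d * t)
    (h4a : Subalgebra.toSubmodule A ≠ ⊥)
    (h4 : ∀ W : Submodule K D, W ≤ Subalgebra.toSubmodule A →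
      (∀ ξ ∈ E, ∀ w ∈ W, ξ w ∈ W) → W = ⊥ ∨ W = Subalgebra.toSubmodule A)
    (h5 : ∀ φ : A →ₗ[K] A,
      (∀ (ξ : Module.End K D) (hξ : ξ ∈ E) (a : A),
        (φ ⟨ξ a, h2 ξ hξ a a.2⟩ : D) = ξ (φ a)) →
      ∃ c : K, ∀ a : A, φ a = c • a)
    {m : ℕ} (α : Fin m → D) (hαA : ∀ i, α i ∈ A) (hLI : LinearIndependent K α)
    (t : Fin m → D) (htT : ∀ i, t i ∈ T)
    (hsum : ∑ i, α i * t i = 0) :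
    ∀ i, t i = 0 := by
  classical
  intro j
  let _ : Ring E := Algebra.semiringToRing K
  let N : Submodule E D :=
    { carrier := A
      add_mem' := A.add_mem
      zero_mem' := A.zero_mem
      smul_mem' := fun ξ a ha => h2 ξ ξ.2 a ha }
  have hN : ∀ W : Submodule E N, W = ⊥ ∨ W = ⊤ := by
    intro W
    let V : Submodule K D := (W.map N.subtype).restrictScalars K
    have hV : ∀ x : N, (x : D) ∈ V ↔ x ∈ W := fun x => by simp [V]
    rcases h4 V (by rintro _ ⟨x, -, rfl⟩; exact x.2)
      (fun ξ hξ w hw => (W.map N.subtype).smul_mem (⟨ξ, hξ⟩ : E) hw) with h | h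
    · refine .inl (eq_bot_iff.2 fun x hx => ?_)
      rw [← hV, h] at hx
      exact Subtype.ext hx
    · refine .inr (eq_top_iff.2 fun x _ => ?_)
      rw [← hV, h]
      exact x.2
  have : Nontrivial N := (Submodule.nontrivial_iff_ne_bot (p := Subalgebra.toSubmodule A)).2 h4a
  have : IsSimpleOrder (Submodule E N) := { eq_bot_or_eq_top := hN }
  have : IsSimpleModule E N := { }
  have hscalar : ∀ φ : Module.End E N, ∃ c : K, ∀ a : N, φ a = c • a := by
    intro φ
    exact h5 (φ.restrictScalars K) fun ξ hξ a =>
      congrArg Subtype.val (φ.map_smul (⟨ξ, hξ⟩ : E) a)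
  obtain ⟨p, hp⟩ := (Finsupp.lapply j ∘ₗ hLI.repr).exists_extend
  have hpα : ∀ i, p (α i) = if i = j then 1 else 0 := by
    intro i
    have := LinearMap.congr_fun hp ⟨α i, Submodule.subset_span ⟨i, rfl⟩⟩
    simpa [hLI.repr_eq_single i, Finsupp.single_apply] using this
  let f : Module.End (Module.End E N) N :=
    { toFun := fun a => p a • (⟨1, A.one_mem⟩ : N)
      map_add' := fun a b => by simp [add_smul]
      map_smul' := fun φ a => by
        obtain ⟨c, hc⟩ := hscalar φ
        simp [hc, mul_smul] }
  obtain ⟨ξ, hξ⟩ := jacobson_density f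
    (Finset.univ.image fun i => (⟨α i, hαA i⟩ : N))
  have hξα : ∀ i, ξ.1 (α i) = if i = j then 1 else 0 := by
    intro i
    have := congrArg Subtype.val (hξ ⟨α i, hαA i⟩ (by simp))
    simpa [f, hpα, eq_comm, Subalgebra.smul_def] using this.symm
  calc t j = ∑ i, ξ.1 (α i) * t i := by simp [hξα]
    _ = ξ.1 (∑ i, α i * t i) := by simp [map_sum, h3 ξ.1 ξ.2 _ _ (htT _)]
    _ = 0 := by rw [hsum, map_zero]
end

section
/- Let L = Σ_{n≥1} (−1)^{n+1} Tⁿ/n ∈ ℚ_p[[T]] be the formal power series of log(1+T). If m ≥ 0 and α_0, α_1, …, α_m ∈ ℤ_p[[T]] satisfy α_0 + α_1·L + α_2·L² + ⋯ + α_m·L^m = 0 in ℚ_p[[T]] (where ℤ_p[[T]] is viewed inside ℚ_p[[T]] via the inclusion ℤ_p ⊆ ℚ_p applied coefficientwise), then α_i = 0 for all i. In other words, the series log(1+T) is algebraically independent over the Iwasawa algebra ℤ_p[[T]]. -/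
open Filter Topology

lemma norm_sum_lt_of_forall_lt {ι E : Type*} [SeminormedAddCommGroup E] [IsUltrametricDist E]
    {s : Finset ι} {f : ι → E} {C : ℝ} (hC : 0 < C) (h : ∀ i ∈ s, ‖f i‖ < C) :
    ‖∑ i ∈ s, f i‖ < C := by
  rcases s.eq_empty_or_nonempty with rfl | hs
  · simpa using hC
  · obtain ⟨i, hi, hle⟩ := IsUltrametricDist.exists_norm_finsetSum_le_of_nonempty hs f
    exact hle.trans_lt (h i hi)

/-- A sequence of reals tending to `0` with a positive term has a greatest term. -/
lemma exists_isGreatest_range_of_tendsto_zero {w : ℕ → ℝ} (hw : Tendsto w atTop (𝓝 0)) {k : ℕ}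
    (hk : 0 < w k) : ∃ M, IsGreatest (Set.range w) M := by
  obtain ⟨N, hN⟩ := eventually_atTop.1 (hw.eventually_lt_const hk)
  obtain ⟨n, -, hn⟩ := Finset.exists_max_image (Finset.range (N + k + 1)) w ⟨0, by simp⟩
  refine ⟨w n, ⟨n, rfl⟩, ?_⟩
  rintro _ ⟨l, rfl⟩
  rcases lt_or_ge l (N + k + 1) with hl | hl
  · exact hn l (by simpa using hl)
  · exact (hN l (by omega)).le.trans (hn k (by simp))

namespace PowerSeries

variable {K : Type*} [NormedField K]

/-- `M` is the attained supremum of the values `‖aₙ‖ rⁿ`, for `f = ∑ aₙ Tⁿ`. -/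
def IsMaxGaussNorm (r : ℝ) (f : PowerSeries K) (M : ℝ) : Prop :=
  IsGreatest (Set.range fun n => ‖coeff n f‖ * r ^ n) M

lemma IsMaxGaussNorm.le {r M : ℝ} {f : PowerSeries K} (hf : IsMaxGaussNorm r f M) (n : ℕ) :
    ‖coeff n f‖ * r ^ n ≤ M :=
  hf.2 ⟨n, rfl⟩

/-- There is a first index at which the Gauss norm is attained. -/
lemma IsMaxGaussNorm.exists_first {r M : ℝ} {f : PowerSeries K} (hf : IsMaxGaussNorm r f M) :
    ∃ i, ‖coeff i f‖ * r ^ i = M ∧ ∀ k < i, ‖coeff k f‖ * r ^ k < M := by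
  classical
  have hex : ∃ i, ‖coeff i f‖ * r ^ i = M := hf.1
  exact ⟨Nat.find hex, Nat.find_spec hex,
    fun k hk => lt_of_le_of_ne (hf.le k) (Nat.find_min hex hk)⟩

lemma isMaxGaussNorm_one {r : ℝ} : IsMaxGaussNorm r (1 : PowerSeries K) 1 := by
  refine ⟨⟨0, by simp⟩, ?_⟩
  rintro _ ⟨n, rfl⟩
  rcases eq_or_ne n 0 with rfl | hn <;> simp [coeff_one, *]

lemma exists_isMaxGaussNorm {r : ℝ} (hr : 0 < r) (hr1 : r < 1) {f : PowerSeries K} (hf : f ≠ 0)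
    (hle : ∀ n, ‖coeff n f‖ ≤ n + 1) : ∃ M, IsMaxGaussNorm r f M := by
  obtain ⟨k, hk⟩ := exists_coeff_ne_zero_iff_ne_zero.2 hf
  refine exists_isGreatest_range_of_tendsto_zero (k := k) ?_
    (mul_pos (norm_pos_iff.2 hk) (pow_pos hr k))
  have hlim : Tendsto (fun n : ℕ => ((n : ℝ) + 1) * r ^ n) atTop (𝓝 0) := by
    simpa [add_mul] using (tendsto_self_mul_const_pow_of_lt_one hr.le hr1).add
      (tendsto_pow_atTop_nhds_zero_of_lt_one hr.le hr1)
  exact squeeze_zero (fun n => by positivity) (fun n => by gcongr; exact hle n) hlim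

variable [IsUltrametricDist K]

lemma norm_coeff_mul_mul_pow_le {r A B : ℝ} (hr : 0 < r) (hA : 0 ≤ A) (hB : 0 ≤ B)
    {f g : PowerSeries K} (hf : ∀ n, ‖coeff n f‖ * r ^ n ≤ A) (hg : ∀ n, ‖coeff n g‖ * r ^ n ≤ B)
    (n : ℕ) : ‖coeff n (f * g)‖ * r ^ n ≤ A * B := by
  rw [← le_div_iff₀ (pow_pos hr n), coeff_mul]
  refine IsUltrametricDist.norm_sum_le_of_forall_le_of_nonneg (by positivity) ?_
  rintro ⟨a, b⟩ hab
  rw [Finset.HasAntidiagonal.mem_antidiagonal] at hab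
  rw [le_div_iff₀ (pow_pos hr n), norm_mul, ← hab, pow_add, mul_mul_mul_comm]
  exact mul_le_mul (hf a) (hg b) (by positivity) hA

/-- Multiplicativity of the Gauss norm. -/
lemma IsMaxGaussNorm.mul {r A B : ℝ} (hr : 0 < r) (hA : 0 < A) (hB : 0 < B)
    {f g : PowerSeries K} (hf : IsMaxGaussNorm r f A) (hg : IsMaxGaussNorm r g B) :
    IsMaxGaussNorm r (f * g) (A * B) := by
  obtain ⟨i, hi, hi'⟩ := hf.exists_first
  obtain ⟨j, hj, hj'⟩ := hg.exists_first
  refine ⟨⟨i + j, ?_⟩, ?_⟩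
  · have hmem : (i, j) ∈ Finset.HasAntidiagonal.antidiagonal (i + j) := by simp
    have hrpow := pow_pos hr (i + j)
    have hmain : ‖coeff i f * coeff j g‖ = A * B / r ^ (i + j) := by
      rw [eq_div_iff hrpow.ne', norm_mul, pow_add, mul_mul_mul_comm, hi, hj]
    have hrest : ‖∑ x ∈ (Finset.HasAntidiagonal.antidiagonal (i + j)).erase (i, j),
        coeff x.1 f * coeff x.2 g‖ < A * B / r ^ (i + j) := by
      refine norm_sum_lt_of_forall_lt (by positivity) ?_
      rintro ⟨a, b⟩ hab
      simp only [Finset.mem_erase, ne_eq, Prod.mk.injEq,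
        Finset.HasAntidiagonal.mem_antidiagonal] at hab
      rw [lt_div_iff₀ hrpow, norm_mul, ← hab.2, pow_add, mul_mul_mul_comm]
      rcases lt_or_ge a i with ha | ha
      · exact mul_lt_mul_of_lt_of_le_of_nonneg_of_pos (hi' a ha) (hg.le b) (by positivity) hB
      · exact mul_lt_mul_of_le_of_lt_of_nonneg_of_pos (hf.le a) (hj' b (by omega)) (by positivity) hA
    simp only [coeff_mul]
    rw [← Finset.add_sum_erase _ _ hmem,
      IsUltrametricDist.norm_add_eq_max_of_norm_ne_norm (by rw [hmain]; exact hrest.ne'),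
      hmain, max_eq_left hrest.le, div_mul_cancel₀ _ hrpow.ne']
  · rintro _ ⟨n, rfl⟩
    exact norm_coeff_mul_mul_pow_le hr hA.le hB.le hf.le hg.le n

lemma IsMaxGaussNorm.pow {r A : ℝ} (hr : 0 < r) (hA : 0 < A) {f : PowerSeries K}
    (hf : IsMaxGaussNorm r f A) (n : ℕ) : IsMaxGaussNorm r (f ^ n) (A ^ n) := by
  induction n with
  | zero => simpa using isMaxGaussNorm_one
  | succ n ih => simpa only [pow_succ] using ih.mul hr (pow_pos hA n) hA hf

/-- Let `L` have coefficients of at most linear growth and Gauss norms unbounded as `r → 1`.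
Then `L` is not a root of a nonzero polynomial with coefficients in the power series bounded
by `1`. -/
lemma eq_zero_of_sum_mul_pow_eq_zero {L : PowerSeries K} (hL : ∀ n, ‖coeff n L‖ ≤ n + 1)
    (hL' : ∀ C : ℝ, ∃ k, C < ‖coeff k L‖) {m : ℕ} (a : Fin (m + 1) → PowerSeries K)
    (ha : ∀ i n, ‖coeff n (a i)‖ ≤ 1) (h : ∑ i, a i * L ^ (i : ℕ) = 0) : ∀ i, a i = 0 := by
  classical
  by_contra! hne
  obtain ⟨d, hd, hmax⟩ := Finset.exists_max_image (Finset.univ.filter fun i => a i ≠ 0) id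
    (by simpa [Finset.Nonempty] using hne)
  simp only [Finset.mem_filter, Finset.mem_univ, true_and, id] at hd hmax
  obtain ⟨l, hl⟩ := exists_coeff_ne_zero_iff_ne_zero.2 hd
  have hl0 : 0 < ‖coeff l (a d)‖ := norm_pos_iff.2 hl
  obtain ⟨k, hk⟩ := hL' (max 1 (1 / ‖coeff l (a d)‖))
  obtain ⟨hk1, hk2⟩ := max_lt_iff.1 hk
  have hk2 : 1 < ‖coeff l (a d)‖ * ‖coeff k L‖ := by rwa [div_lt_iff₀' hl0] at hk2
  -- A radius close enough to `1` preserves both strict inequalities.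
  obtain ⟨r, ⟨hr1, hr2⟩, hr0, hrlt⟩ : ∃ r : ℝ, (1 < ‖coeff k L‖ * r ^ k ∧
      1 < (‖coeff l (a d)‖ * r ^ l) * (‖coeff k L‖ * r ^ k)) ∧ 0 < r ∧ r < 1 := by
    have h1 : Tendsto (fun r : ℝ => ‖coeff k L‖ * r ^ k) (𝓝[<] 1) (𝓝 (‖coeff k L‖ * 1 ^ k)) :=
      (Continuous.tendsto (by fun_prop) 1).mono_left nhdsWithin_le_nhds
    have h2 : Tendsto (fun r : ℝ => (‖coeff l (a d)‖ * r ^ l) * (‖coeff k L‖ * r ^ k)) (𝓝[<] 1)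
        (𝓝 ((‖coeff l (a d)‖ * 1 ^ l) * (‖coeff k L‖ * 1 ^ k))) :=
      (Continuous.tendsto (by fun_prop) 1).mono_left nhdsWithin_le_nhds
    exact (((h1.eventually_const_lt (by simpa using hk1)).and
      (h2.eventually_const_lt (by simpa using hk2))).and
      (Ioo_mem_nhdsLT (zero_lt_one' ℝ))).exists
  obtain ⟨M, hM⟩ := exists_isMaxGaussNorm hr0 hrlt
    (exists_coeff_ne_zero_iff_ne_zero.1 ⟨k, norm_pos_iff.1 (zero_lt_one.trans hk1)⟩) hL
  obtain ⟨A, hA⟩ := exists_isMaxGaussNorm hr0 hrlt hd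
    fun n => (ha d n).trans (by linarith [Nat.cast_nonneg (α := ℝ) n])
  have hM1 : 1 < M := hr1.trans_le (hM.le k)
  have hM0 : 0 < M := zero_lt_one.trans hM1
  have hA0 : 0 < A := (mul_pos hl0 (pow_pos hr0 l)).trans_le (hA.le l)
  have hAM : 1 < A * M :=
    hr2.trans_le (mul_le_mul (hA.le l) (hM.le k) (by positivity) hA0.le)
  obtain ⟨n, hn⟩ := (hA.mul hr0 hA0 (pow_pos hM0 d) (hM.pow hr0 hM0 d)).1
  dsimp only at hn
  have hrn := pow_pos hr0 n
  have hlt : ‖coeff n (∑ i ∈ Finset.univ.erase d, a i * L ^ (i : ℕ))‖ <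
      A * M ^ (d : ℕ) / r ^ n := by
    rw [map_sum]
    refine norm_sum_lt_of_forall_lt (by positivity) fun i hi => ?_
    rcases lt_or_ge d i with hdi | hid
    · have : a i = 0 := by
        by_contra hi0
        exact absurd (hmax i hi0) (not_le.2 hdi)
      simp only [this, zero_mul, map_zero, norm_zero]
      positivity
    · have hid : (i : ℕ) < d := lt_of_le_of_ne hid fun e => Finset.ne_of_mem_erase hi (Fin.ext e)
      rw [lt_div_iff₀ hrn]
      calc ‖coeff n (a i * L ^ (i : ℕ))‖ * r ^ n ≤ 1 * M ^ (i : ℕ) :=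
            norm_coeff_mul_mul_pow_le hr0 zero_le_one (by positivity)
              (fun n => mul_le_one₀ (ha i n) (by positivity) (pow_le_one₀ hr0.le hrlt.le))
              (hM.pow hr0 hM0 i).le n
        _ < A * M * M ^ (i : ℕ) := by gcongr
        _ = A * M ^ ((i : ℕ) + 1) := by ring
        _ ≤ A * M ^ (d : ℕ) := by gcongr; exacts [hM1.le, hid]
  rw [← Finset.add_sum_erase _ _ (Finset.mem_univ d)] at h
  rw [← neg_eq_of_add_eq_zero_right h, map_neg, norm_neg, lt_div_iff₀ hrn, hn] at hlt
  exact lt_irrefl _ hlt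

end PowerSeries

lemma Padic.norm_inv_natCast_le (p : ℕ) [Fact p.Prime] (n : ℕ) : ‖(n : ℚ_[p])‖⁻¹ ≤ n := by
  rcases eq_or_ne n 0 with rfl | hn
  · simp
  have hp : (0 : ℝ) < p := by exact_mod_cast (Fact.out : p.Prime).pos
  rw [Padic.norm_eq_zpow_neg_valuation (by exact_mod_cast hn), Padic.valuation_natCast, zpow_neg,
    inv_inv, zpow_natCast]
  exact_mod_cast Nat.le_of_dvd (Nat.pos_of_ne_zero hn) pow_padicValNat_dvd


/-- The formal power series `log(1+T) = Σ_{n ≥ 1} (-1)^{n+1} Tⁿ/n` over `ℚ_p` is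
algebraically independent over the Iwasawa algebra `ℤ_p[[T]]`: any polynomial relation
`α₀ + α₁·L + ⋯ + α_m·L^m = 0` with coefficients `α_i ∈ ℤ_p[[T]]` forces all `α_i = 0`.
(Note that the coefficient `(-1)^{n+1}/n` of `Tⁿ` equals `0` when `n = 0`, since division by
zero is zero.) -/
theorem log_one_add_T_algebraically_independent (p : ℕ) [Fact p.Prime] (m : ℕ)
    (α : Fin (m + 1) → PowerSeries ℤ_[p])
    (h : ∑ i : Fin (m + 1), (PowerSeries.map (algebraMap ℤ_[p] ℚ_[p]) (α i)) *
        (PowerSeries.mk fun n => (-1 : ℚ_[p]) ^ (n + 1) / (n : ℚ_[p])) ^ (i : ℕ) = 0) :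
    ∀ i, α i = 0 := by
  have hnorm (n : ℕ) : ‖(-1 : ℚ_[p]) ^ (n + 1) / (n : ℚ_[p])‖ = ‖(n : ℚ_[p])‖⁻¹ := by simp
  have hzero := PowerSeries.eq_zero_of_sum_mul_pow_eq_zero (fun n => ?_) (fun C => ?_)
    (fun i => PowerSeries.map (algebraMap ℤ_[p] ℚ_[p]) (α i)) (fun i n => ?_) h
  · exact fun i => PowerSeries.map_injective _ (FaithfulSMul.algebraMap_injective ℤ_[p] ℚ_[p])
      ((hzero i).trans (map_zero _).symm)
  · rw [PowerSeries.coeff_mk, hnorm]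
    exact (Padic.norm_inv_natCast_le p n).trans (by linarith)
  · obtain ⟨k, hk⟩ := pow_unbounded_of_one_lt C
      (by exact_mod_cast (Fact.out : p.Prime).one_lt : (1 : ℝ) < p)
    refine ⟨p ^ k, ?_⟩
    rw [PowerSeries.coeff_mk, hnorm]
    simpa using hk
  · rw [PowerSeries.coeff_map]
    exact PadicInt.norm_le_one _
end
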